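/- Suppose T is Σ1-sound. For each m ≥ 1, there exists no Σ1 provability predicate PR_T(x) of T such that N⁺A_{m,0} ⊆ PL(PR_T). -/

import Mathlib

namespace PLN

/-! ### Modal formulas and the logics N⁺A_{m,n} -/

/-- Formulas of modal propositional logic. -/
inductive MFml : Type
  | var : ℕ → MFml
  | bot : MFml
  | neg : MFml → MFml
  | and : MFml → MFml → MFml
  | or : MFml → MFml → MFml
  | imp : MFml → MFml → MFml
  | box : MFml → MFml
  deriving DecidableEq

/-- `boxIter n A` is `□ⁿ A`, where `□⁰ A = A` and `□^(k+1) A = □ (□ᵏ A)`. -/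
def boxIter : ℕ → MFml → MFml
  | 0, A => A
  | k + 1, A => .box (boxIter k A)

/-- Evaluation of a modal formula under a valuation of its "propositional atoms"
(propositional variables, and boxed formulas); used to define propositional tautologies
in the modal language. -/
def MFml.evalTC (v : MFml → Prop) : MFml → Prop
  | .bot => False
  | .neg A => ¬ A.evalTC v
  | .and A B => A.evalTC v ∧ B.evalTC v
  | .or A B => A.evalTC v ∨ B.evalTC v
  | .imp A B => A.evalTC v → B.evalTC v
  | A => v A

/-- Propositional tautologies in the modal language. -/
def MTaut (A : MFml) : Prop := ∀ v, A.evalTC v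

/-- Provability in the logic `N⁺A_{m,n}`: the pure logic of necessitation `N`
(propositional tautologies, modus ponens, necessitation) together with the axiom scheme
`□ⁿA → □ᵐA` and the rule `Ros□` (from `¬□A` infer `¬□□A`). -/
inductive NAProves (m n : ℕ) : MFml → Prop
  | taut {A} : MTaut A → NAProves m n A
  | acc (A) : NAProves m n (.imp (boxIter n A) (boxIter m A))
  | mp {A B} : NAProves m n (.imp A B) → NAProves m n A → NAProves m n B
  | nec {A} : NAProves m n A → NAProves m n (.box A)
  | ros {A} : NAProves m n (.neg (.box A)) → NAProves m n (.neg (.box (.box A)))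

/-- `IsSub B A` : `B` is a subformula of `A`. -/
inductive IsSub : MFml → MFml → Prop
  | refl (A) : IsSub A A
  | neg {B A} : IsSub B A → IsSub B (.neg A)
  | andL {B A C} : IsSub B A → IsSub B (.and A C)
  | andR {B A C} : IsSub B C → IsSub B (.and A C)
  | orL {B A C} : IsSub B A → IsSub B (.or A C)
  | orR {B A C} : IsSub B C → IsSub B (.or A C)
  | impL {B A C} : IsSub B A → IsSub B (.imp A C)
  | impR {B A C} : IsSub B C → IsSub B (.imp A C)
  | box {B A} : IsSub B A → IsSub B (.box A)

/-! ### N-frames and N-models -/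

/-- An N-model on a set `W` of worlds: an N-frame (a binary relation `≺_B` on `W`
for each modal formula `B`) together with a valuation of propositional variables. -/
structure NModel (W : Type) where
  rel : MFml → W → W → Prop
  val : W → ℕ → Prop

/-- The forcing relation of an N-model:
`x ⊩ □B` iff every `y` with `x ≺_B y` satisfies `y ⊩ B`. -/
def NModel.Forces {W : Type} (M : NModel W) : W → MFml → Prop
  | x, .var p => M.val x p
  | _, .bot => False
  | x, .neg A => ¬ NModel.Forces M x A
  | x, .and A B => NModel.Forces M x A ∧ NModel.Forces M x B
  | x, .or A B => NModel.Forces M x A ∨ NModel.Forces M x B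
  | x, .imp A B => NModel.Forces M x A → NModel.Forces M x B
  | x, .box A => ∀ y, M.rel A x y → NModel.Forces M y A

/-- The relations `≺_B^k` : `x ≺_B^0 y` iff `x = y`, and
`x ≺_B^(k+1) y` iff `∃ w, x ≺_{□ᵏB} w` and `w ≺_B^k y`. -/
def NModel.relIter {W : Type} (M : NModel W) (B : MFml) : ℕ → W → W → Prop
  | 0, x, y => x = y
  | k + 1, x, y => ∃ w, M.rel (boxIter k B) x w ∧ NModel.relIter M B k w y

/-- `(m,n)`-accessibility of (the frame of) an N-model. -/
def NModel.Accessible {W : Type} (M : NModel W) (m n : ℕ) : Prop :=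
  ∀ (B : MFml) (x y : W), NModel.relIter M B m x y → NModel.relIter M B n x y

/-! ### The language of first-order arithmetic -/

/-- Terms of the language of arithmetic, with de Bruijn variables. -/
inductive ATerm : Type
  | var : ℕ → ATerm
  | zero : ATerm
  | succ : ATerm → ATerm
  | add : ATerm → ATerm → ATerm
  | mul : ATerm → ATerm → ATerm
  deriving DecidableEq

/-- Formulas of the language of arithmetic (with `≤` primitive), de Bruijn variables. -/
inductive AFml : Type
  | eq : ATerm → ATerm → AFml
  | le : ATerm → ATerm → AFml
  | neg : AFml → AFml
  | and : AFml → AFml → AFml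
  | or : AFml → AFml → AFml
  | imp : AFml → AFml → AFml
  | all : AFml → AFml
  | ex : AFml → AFml
  deriving DecidableEq

/-- Lift (shift up by one) the variables `≥ c` of a term. -/
def ATerm.lift (c : ℕ) : ATerm → ATerm
  | .var n => .var (if n < c then n else n + 1)
  | .zero => .zero
  | .succ t => .succ (t.lift c)
  | .add t s => .add (t.lift c) (s.lift c)
  | .mul t s => .mul (t.lift c) (s.lift c)

/-- Simultaneous substitution in terms. -/
def ATerm.substAll (σ : ℕ → ATerm) : ATerm → ATerm
  | .var n => σ n
  | .zero => .zero
  | .succ t => .succ (t.substAll σ)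
  | .add t s => .add (t.substAll σ) (s.substAll σ)
  | .mul t s => .mul (t.substAll σ) (s.substAll σ)

/-- Pushing a substitution under a binder. -/
def liftSub (σ : ℕ → ATerm) : ℕ → ATerm
  | 0 => .var 0
  | n + 1 => (σ n).lift 0

/-- Lift (shift up by one) the free variables `≥ c` of a formula. -/
def AFml.lift (c : ℕ) : AFml → AFml
  | .eq t s => .eq (t.lift c) (s.lift c)
  | .le t s => .le (t.lift c) (s.lift c)
  | .neg φ => .neg (φ.lift c)
  | .and φ ψ => .and (φ.lift c) (ψ.lift c)
  | .or φ ψ => .or (φ.lift c) (ψ.lift c)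
  | .imp φ ψ => .imp (φ.lift c) (ψ.lift c)
  | .all φ => .all (φ.lift (c + 1))
  | .ex φ => .ex (φ.lift (c + 1))

/-- Simultaneous (capture-avoiding) substitution in formulas. -/
def AFml.substAll (σ : ℕ → ATerm) : AFml → AFml
  | .eq t s => .eq (t.substAll σ) (s.substAll σ)
  | .le t s => .le (t.substAll σ) (s.substAll σ)
  | .neg φ => .neg (φ.substAll σ)
  | .and φ ψ => .and (φ.substAll σ) (ψ.substAll σ)
  | .or φ ψ => .or (φ.substAll σ) (ψ.substAll σ)
  | .imp φ ψ => .imp (φ.substAll σ) (ψ.substAll σ)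
  | .all φ => .all (φ.substAll (liftSub σ))
  | .ex φ => .ex (φ.substAll (liftSub σ))

def subst0Env (t : ATerm) : ℕ → ATerm
  | 0 => t
  | n + 1 => .var n

def subst2Env (t s : ATerm) : ℕ → ATerm
  | 0 => t
  | 1 => s
  | n + 2 => .var n

/-- Substitute the term `t` for the free variable `0` (decrementing other variables). -/
def AFml.subst0 (φ : AFml) (t : ATerm) : AFml := φ.substAll (subst0Env t)

/-- Substitute the terms `t`, `s` for the free variables `0`, `1` simultaneously. -/
def AFml.subst2 (φ : AFml) (t s : ATerm) : AFml := φ.substAll (subst2Env t s)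

/-- Substitute `S(var 0)` for `var 0`, leaving all other free variables unchanged. -/
def succSubst (φ : AFml) : AFml :=
  φ.substAll fun n => if n = 0 then .succ (.var 0) else .var n

/-- All variables of a term are `< c`. -/
def ATerm.FreeLt (c : ℕ) : ATerm → Prop
  | .var n => n < c
  | .zero => True
  | .succ t => t.FreeLt c
  | .add t s => t.FreeLt c ∧ s.FreeLt c
  | .mul t s => t.FreeLt c ∧ s.FreeLt c

/-- All free variables of a formula are `< c`; `FreeLt 0 φ` says that `φ` is a sentence. -/
def AFml.FreeLt (c : ℕ) : AFml → Prop
  | .eq t s => t.FreeLt c ∧ s.FreeLt c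
  | .le t s => t.FreeLt c ∧ s.FreeLt c
  | .neg φ => φ.FreeLt c
  | .and φ ψ => φ.FreeLt c ∧ ψ.FreeLt c
  | .or φ ψ => φ.FreeLt c ∧ ψ.FreeLt c
  | .imp φ ψ => φ.FreeLt c ∧ ψ.FreeLt c
  | .all φ => φ.FreeLt (c + 1)
  | .ex φ => φ.FreeLt (c + 1)

/-- The numeral `n̄`. -/
def numeral : ℕ → ATerm
  | 0 => .zero
  | n + 1 => .succ (numeral n)

/-- A Gödel numbering of terms. -/
def ATerm.code : ATerm → ℕ
  | .var n => Nat.pair 0 n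
  | .zero => Nat.pair 1 0
  | .succ t => Nat.pair 2 t.code
  | .add t s => Nat.pair 3 (Nat.pair t.code s.code)
  | .mul t s => Nat.pair 4 (Nat.pair t.code s.code)

/-- A Gödel numbering of formulas. -/
def AFml.code : AFml → ℕ
  | .eq t s => Nat.pair 0 (Nat.pair t.code s.code)
  | .le t s => Nat.pair 1 (Nat.pair t.code s.code)
  | .neg φ => Nat.pair 2 φ.code
  | .and φ ψ => Nat.pair 3 (Nat.pair φ.code ψ.code)
  | .or φ ψ => Nat.pair 4 (Nat.pair φ.code ψ.code)
  | .imp φ ψ => Nat.pair 5 (Nat.pair φ.code ψ.code)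
  | .all φ => Nat.pair 6 φ.code
  | .ex φ => Nat.pair 7 φ.code

/-- `⌜φ⌝`, the numeral of the Gödel number of `φ`. -/
def gnum (φ : AFml) : ATerm := numeral φ.code

/-- For a formula `P(x)` (with free variable `var 0`), `P.appNum φ` is `P(⌜φ⌝)`. -/
def AFml.appNum (P φ : AFml) : AFml := P.subst0 (gnum φ)

/-- Iterated application of a predicate: `iterPred P k φ = P(⌜P(⌜⋯P(⌜φ⌝)⋯⌝)⌝)` (`k` times). -/
def iterPred (P : AFml) : ℕ → AFml → AFml
  | 0, φ => φ
  | k + 1, φ => P.appNum (iterPred P k φ)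

/-! ### Satisfaction in the standard model -/

def ATerm.val (ρ : ℕ → ℕ) : ATerm → ℕ
  | .var n => ρ n
  | .zero => 0
  | .succ t => t.val ρ + 1
  | .add t s => t.val ρ + s.val ρ
  | .mul t s => t.val ρ * s.val ρ

def consEnv (a : ℕ) (ρ : ℕ → ℕ) : ℕ → ℕ
  | 0 => a
  | n + 1 => ρ n

/-- Satisfaction in the standard model `ℕ` under an environment `ρ`. -/
def AFml.Sat (ρ : ℕ → ℕ) : AFml → Prop
  | .eq t s => t.val ρ = s.val ρ
  | .le t s => t.val ρ ≤ s.val ρ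
  | .neg φ => ¬ φ.Sat ρ
  | .and φ ψ => φ.Sat ρ ∧ ψ.Sat ρ
  | .or φ ψ => φ.Sat ρ ∨ ψ.Sat ρ
  | .imp φ ψ => φ.Sat ρ → ψ.Sat ρ
  | .all φ => ∀ a, φ.Sat (consEnv a ρ)
  | .ex φ => ∃ a, φ.Sat (consEnv a ρ)

/-- `ℕ ⊨ φ`. -/
def TrueN (φ : AFml) : Prop := φ.Sat fun _ => 0

/-! ### The arithmetical hierarchy: Δ₀, Σ₁, Π₁ -/

/-- `Δ₀` formulas: every quantifier is bounded. -/
inductive IsDelta0 : AFml → Prop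
  | eq (t s : ATerm) : IsDelta0 (.eq t s)
  | le (t s : ATerm) : IsDelta0 (.le t s)
  | neg {φ} : IsDelta0 φ → IsDelta0 (.neg φ)
  | and {φ ψ} : IsDelta0 φ → IsDelta0 ψ → IsDelta0 (.and φ ψ)
  | or {φ ψ} : IsDelta0 φ → IsDelta0 ψ → IsDelta0 (.or φ ψ)
  | imp {φ ψ} : IsDelta0 φ → IsDelta0 ψ → IsDelta0 (.imp φ ψ)
  | ball {φ : AFml} (t : ATerm) : IsDelta0 φ → IsDelta0 (.all (.imp (.le (.var 0) (ATerm.lift 0 t)) φ))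
  | bex {φ : AFml} (t : ATerm) : IsDelta0 φ → IsDelta0 (.ex (.and (.le (.var 0) (ATerm.lift 0 t)) φ))

mutual
  /-- `Σ₁` formulas. -/
  inductive IsSigma1 : AFml → Prop
    | delta0 {φ} : IsDelta0 φ → IsSigma1 φ
    | and {φ ψ} : IsSigma1 φ → IsSigma1 ψ → IsSigma1 (.and φ ψ)
    | or {φ ψ} : IsSigma1 φ → IsSigma1 ψ → IsSigma1 (.or φ ψ)
    | ex {φ} : IsSigma1 φ → IsSigma1 (.ex φ)
    | negPi {φ} : IsPi1 φ → IsSigma1 (.neg φ)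
    | impPiSigma {φ ψ} : IsPi1 φ → IsSigma1 ψ → IsSigma1 (.imp φ ψ)
  /-- `Π₁` formulas. -/
  inductive IsPi1 : AFml → Prop
    | delta0 {φ} : IsDelta0 φ → IsPi1 φ
    | and {φ ψ} : IsPi1 φ → IsPi1 ψ → IsPi1 (.and φ ψ)
    | or {φ ψ} : IsPi1 φ → IsPi1 ψ → IsPi1 (.or φ ψ)
    | all {φ} : IsPi1 φ → IsPi1 (.all φ)
    | negSigma {φ} : IsSigma1 φ → IsPi1 (.neg φ)
    | impSigmaPi {φ ψ} : IsSigma1 φ → IsPi1 ψ → IsPi1 (.imp φ ψ)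
end

/-! ### A Hilbert-style proof system for first-order arithmetic -/

/-- Evaluation of an arithmetical formula under a valuation of its "propositionally atomic"
subformulas (atomic or quantified formulas); used for propositional tautologies and
tautological consequence. -/
def AFml.evalProp (v : AFml → Prop) : AFml → Prop
  | .neg φ => ¬ φ.evalProp v
  | .and φ ψ => φ.evalProp v ∧ ψ.evalProp v
  | .or φ ψ => φ.evalProp v ∨ ψ.evalProp v
  | .imp φ ψ => φ.evalProp v → ψ.evalProp v
  | φ => v φ

/-- Propositional tautologies in the language of arithmetic. -/
def ATaut (φ : AFml) : Prop := ∀ v, φ.evalProp v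

/-- `φ` is a tautological consequence of the set `X` of formulas. -/
def TC (X : Set AFml) (φ : AFml) : Prop :=
  ∀ v : AFml → Prop, (∀ ψ ∈ X, ψ.evalProp v) → φ.evalProp v

def iffF (φ ψ : AFml) : AFml := .and (.imp φ ψ) (.imp ψ φ)

/-- Hilbert-style provability from the set of axioms `Γ` in classical first-order
logic with equality. -/
inductive Proves (Γ : Set AFml) : AFml → Prop
  | ax {φ} : φ ∈ Γ → Proves Γ φ
  | taut {φ} : ATaut φ → Proves Γ φ
  | mp {φ ψ} : Proves Γ (.imp φ ψ) → Proves Γ φ → Proves Γ ψ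
  | allE (φ : AFml) (t : ATerm) : Proves Γ (.imp (.all φ) (φ.subst0 t))
  | exI (φ : AFml) (t : ATerm) : Proves Γ (.imp (φ.subst0 t) (.ex φ))
  | allImp (φ ψ : AFml) : Proves Γ (.imp (.all (.imp φ ψ)) (.imp (.all φ) (.all ψ)))
  | vacAll (φ : AFml) : Proves Γ (.imp φ (.all (AFml.lift 0 φ)))
  | exDef (φ : AFml) : Proves Γ (iffF (.ex φ) (.neg (.all (.neg φ))))
  | gen {φ} : Proves Γ φ → Proves Γ (.all φ)
  | eqRefl (t : ATerm) : Proves Γ (.eq t t)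
  | eqSubst (φ : AFml) (t s : ATerm) : Proves Γ (.imp (.eq t s) (.imp (φ.subst0 t) (φ.subst0 s)))

/-! ### Peano arithmetic -/

/-- The axioms of Peano arithmetic. -/
inductive PAax : AFml → Prop
  | succNeZero : PAax (.all (.neg (.eq (.succ (.var 0)) .zero)))
  | succInj :
      PAax (.all (.all (.imp (.eq (.succ (.var 1)) (.succ (.var 0))) (.eq (.var 1) (.var 0)))))
  | addZero : PAax (.all (.eq (.add (.var 0) .zero) (.var 0)))
  | addSucc :
      PAax (.all (.all (.eq (.add (.var 1) (.succ (.var 0))) (.succ (.add (.var 1) (.var 0))))))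
  | mulZero : PAax (.all (.eq (.mul (.var 0) .zero) .zero))
  | mulSucc :
      PAax (.all (.all (.eq (.mul (.var 1) (.succ (.var 0)))
        (.add (.mul (.var 1) (.var 0)) (.var 1)))))
  | leDef :
      PAax (.all (.all (iffF (.le (.var 1) (.var 0))
        (.ex (.eq (.add (.var 0) (.var 2)) (.var 1))))))
  | ind (φ : AFml) :
      PAax (.imp (.and (φ.subst0 .zero) (.all (.imp φ (succSubst φ)))) (.all φ))

/-- Peano arithmetic, as a set of axioms. -/
def PA : Set AFml := {φ | PAax φ}

/-- The sentence `0 = 1`. -/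
def botFml : AFml := .eq .zero (.succ .zero)

/-- `t < s`, as the formula `S(t) ≤ s`. -/
def ltF (t s : ATerm) : AFml := .le (.succ t) s

/-- `Δ₁(PA)` formulas: `Σ₁` formulas which are `PA`-provably equivalent to a `Π₁` formula. -/
def IsDelta1PA (φ : AFml) : Prop :=
  IsSigma1 φ ∧ ∃ ψ, IsPi1 ψ ∧ Proves PA (iffF φ ψ)

/-! ### Theories, provability predicates, arithmetical interpretations -/

/-- `Tax` is primitive recursively axiomatized (via the Gödel numbering). -/
def PrAxiomatized (Tax : Set AFml) : Prop :=
  ∃ p : ℕ → Bool, Primrec p ∧ ∀ φ : AFml, φ ∈ Tax ↔ p φ.code = true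

/-- `Σ₁`-soundness: every `T`-provable `Σ₁` sentence is true in `ℕ`. -/
def Sigma1Sound (Tax : Set AFml) : Prop :=
  ∀ φ : AFml, IsSigma1 φ → φ.FreeLt 0 → Proves Tax φ → TrueN φ

/-- `P` is a provability predicate of `T`: a formula `P(x)` with at most the free
variable `x` such that for every formula `φ`, `T ⊢ φ` iff `PA ⊢ P(⌜φ⌝)`. -/
def IsProvPred (Tax : Set AFml) (P : AFml) : Prop :=
  P.FreeLt 1 ∧ ∀ φ : AFml, Proves Tax φ ↔ Proves PA (P.appNum φ)

/-- `f` is an arithmetical interpretation based on the predicate `P`. -/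
def IsInterp (P : AFml) (f : MFml → AFml) : Prop :=
  (∀ i, (f (.var i)).FreeLt 0) ∧
  f .bot = botFml ∧
  (∀ A, f (.neg A) = .neg (f A)) ∧
  (∀ A B, f (.and A B) = .and (f A) (f B)) ∧
  (∀ A B, f (.or A B) = .or (f A) (f B)) ∧
  (∀ A B, f (.imp A B) = .imp (f A) (f B)) ∧
  (∀ A, f (.box A) = P.appNum (f A))

/-- The provability logic of the predicate `P` (relative to the theory `Tax`). -/
def PL (Tax : Set AFml) (P : AFml) : Set MFml :=
  {A | ∀ f : MFml → AFml, IsInterp P f → Proves Tax (f A)}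

/-- The formulas with a `T`-proof of code `≤ s` (relative to a proof enumeration `prf`). -/
def PTset (prf : ℕ → Option AFml) (s : ℕ) : Set AFml :=
  {φ | ∃ y ≤ s, prf y = some φ}

/-! ### Substitution lemmas -/

theorem numeral_lift (k c : ℕ) : (numeral k).lift c = numeral k := by
  induction k with
  | zero => rfl
  | succ k ih => simp [numeral, ATerm.lift, ih]

theorem numeral_subst (k : ℕ) (σ : ℕ → ATerm) : (numeral k).substAll σ = numeral k := by
  induction k with
  | zero => rfl
  | succ k ih => simp [numeral, ATerm.substAll, ih]

theorem numeral_val (k : ℕ) (ρ : ℕ → ℕ) : (numeral k).val ρ = k := by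
  induction k with
  | zero => rfl
  | succ k ih => simp [numeral, ATerm.val, ih]

theorem numeral_free (k c : ℕ) : (numeral k).FreeLt c := by
  induction k with
  | zero => trivial
  | succ k ih => simpa [numeral, ATerm.FreeLt] using ih

theorem term_lift_subst0 (t s : ATerm) : (t.lift 0).substAll (subst0Env s) = t := by
  induction t <;> simp_all [ATerm.lift, ATerm.substAll, subst0Env]

theorem term_lift_liftSub (σ : ℕ → ATerm) (t : ATerm) :
    (t.lift 0).substAll (liftSub σ) = (t.substAll σ).lift 0 := by
  induction t <;> simp_all [ATerm.lift, ATerm.substAll, liftSub]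

theorem term_subst_comp (σ τ : ℕ → ATerm) (t : ATerm) :
    (t.substAll σ).substAll τ = t.substAll (fun n => (σ n).substAll τ) := by
  induction t <;> simp_all [ATerm.substAll]

theorem liftSub_comp (σ τ : ℕ → ATerm) :
    (fun n => (liftSub σ n).substAll (liftSub τ)) = liftSub (fun n => (σ n).substAll τ) := by
  funext n
  cases n with
  | zero => rfl
  | succ n => exact term_lift_liftSub τ (σ n)

theorem fml_subst_comp (φ : AFml) : ∀ σ τ : ℕ → ATerm,
    (φ.substAll σ).substAll τ = φ.substAll (fun n => (σ n).substAll τ) := by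
  induction φ <;> intro σ τ <;> simp_all [AFml.substAll, term_subst_comp, liftSub_comp]

theorem term_subst_id (t : ATerm) (c : ℕ) (σ : ℕ → ATerm) (hσ : ∀ n < c, σ n = .var n)
    (h : t.FreeLt c) : t.substAll σ = t := by
  induction t <;> simp_all [ATerm.substAll, ATerm.FreeLt]

theorem liftSub_id (c : ℕ) (σ : ℕ → ATerm) (hσ : ∀ n < c, σ n = .var n) :
    ∀ n < c + 1, liftSub σ n = .var n := by
  intro n hn
  cases n with
  | zero => rfl
  | succ n => simp [liftSub, hσ n (by omega), ATerm.lift]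

theorem fml_subst_id (φ : AFml) : ∀ (c : ℕ) (σ : ℕ → ATerm), (∀ n < c, σ n = .var n) →
    φ.FreeLt c → φ.substAll σ = φ := by
  induction φ with
  | eq t s => intro c σ hσ h; simp [AFml.substAll, term_subst_id _ c σ hσ h.1, term_subst_id _ c σ hσ h.2]
  | le t s => intro c σ hσ h; simp [AFml.substAll, term_subst_id _ c σ hσ h.1, term_subst_id _ c σ hσ h.2]
  | neg φ ih => intro c σ hσ h; simp [AFml.substAll, ih c σ hσ h]
  | and φ ψ ih1 ih2 => intro c σ hσ h; simp [AFml.substAll, ih1 c σ hσ h.1, ih2 c σ hσ h.2]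
  | or φ ψ ih1 ih2 => intro c σ hσ h; simp [AFml.substAll, ih1 c σ hσ h.1, ih2 c σ hσ h.2]
  | imp φ ψ ih1 ih2 => intro c σ hσ h; simp [AFml.substAll, ih1 c σ hσ h.1, ih2 c σ hσ h.2]
  | all φ ih => intro c σ hσ h; simp [AFml.substAll, ih (c+1) _ (liftSub_id c σ hσ) h]
  | ex φ ih => intro c σ hσ h; simp [AFml.substAll, ih (c+1) _ (liftSub_id c σ hσ) h]

theorem term_free_subst (t : ATerm) (c d : ℕ) (σ : ℕ → ATerm) (hσ : ∀ n < c, (σ n).FreeLt d)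
    (h : t.FreeLt c) : (t.substAll σ).FreeLt d := by
  induction t <;> simp_all [ATerm.substAll, ATerm.FreeLt]

theorem term_free_lift (t : ATerm) (d : ℕ) (h : t.FreeLt d) : (t.lift 0).FreeLt (d + 1) := by
  induction t <;> simp_all [ATerm.lift, ATerm.FreeLt]

theorem liftSub_free (c d : ℕ) (σ : ℕ → ATerm) (hσ : ∀ n < c, (σ n).FreeLt d) :
    ∀ n < c + 1, (liftSub σ n).FreeLt (d + 1) := by
  intro n hn
  cases n with
  | zero => simp [liftSub, ATerm.FreeLt]
  | succ n => exact term_free_lift _ _ (hσ n (by omega))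

theorem fml_free_subst (φ : AFml) : ∀ (c d : ℕ) (σ : ℕ → ATerm), (∀ n < c, (σ n).FreeLt d) →
    φ.FreeLt c → (φ.substAll σ).FreeLt d := by
  induction φ with
  | eq t s => intro c d σ hσ h; exact ⟨term_free_subst _ c d σ hσ h.1, term_free_subst _ c d σ hσ h.2⟩
  | le t s => intro c d σ hσ h; exact ⟨term_free_subst _ c d σ hσ h.1, term_free_subst _ c d σ hσ h.2⟩
  | neg φ ih => intro c d σ hσ h; exact ih c d σ hσ h
  | and φ ψ ih1 ih2 => intro c d σ hσ h; exact ⟨ih1 c d σ hσ h.1, ih2 c d σ hσ h.2⟩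
  | or φ ψ ih1 ih2 => intro c d σ hσ h; exact ⟨ih1 c d σ hσ h.1, ih2 c d σ hσ h.2⟩
  | imp φ ψ ih1 ih2 => intro c d σ hσ h; exact ⟨ih1 c d σ hσ h.1, ih2 c d σ hσ h.2⟩
  | all φ ih => intro c d σ hσ h; exact ih (c+1) (d+1) _ (liftSub_free c d σ hσ) h
  | ex φ ih => intro c d σ hσ h; exact ih (c+1) (d+1) _ (liftSub_free c d σ hσ) h

theorem term_free_mono (t : ATerm) (c d : ℕ) (hcd : c ≤ d) (h : t.FreeLt c) : t.FreeLt d := by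
  induction t with
  | var n => exact lt_of_lt_of_le (show n < c from h) hcd
  | _ => simp_all [ATerm.FreeLt]

theorem fml_free_mono (φ : AFml) : ∀ c d : ℕ, c ≤ d → φ.FreeLt c → φ.FreeLt d := by
  induction φ with
  | eq t s => intro c d hcd h; exact ⟨term_free_mono _ _ _ hcd h.1, term_free_mono _ _ _ hcd h.2⟩
  | le t s => intro c d hcd h; exact ⟨term_free_mono _ _ _ hcd h.1, term_free_mono _ _ _ hcd h.2⟩
  | neg φ ih => intro c d hcd h; exact ih c d hcd h
  | and φ ψ ih1 ih2 => intro c d hcd h; exact ⟨ih1 c d hcd h.1, ih2 c d hcd h.2⟩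
  | or φ ψ ih1 ih2 => intro c d hcd h; exact ⟨ih1 c d hcd h.1, ih2 c d hcd h.2⟩
  | imp φ ψ ih1 ih2 => intro c d hcd h; exact ⟨ih1 c d hcd h.1, ih2 c d hcd h.2⟩
  | all φ ih => intro c d hcd h; exact ih (c+1) (d+1) (by omega) h
  | ex φ ih => intro c d hcd h; exact ih (c+1) (d+1) (by omega) h

/-! ### Semantics lemmas -/

theorem term_val_lift (t : ATerm) (a : ℕ) (ρ : ℕ → ℕ) :
    (t.lift 0).val (consEnv a ρ) = t.val ρ := by
  induction t <;> simp_all [ATerm.lift, ATerm.val, consEnv]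

theorem term_val_subst (t : ATerm) (σ : ℕ → ATerm) (ρ : ℕ → ℕ) :
    (t.substAll σ).val ρ = t.val (fun n => (σ n).val ρ) := by
  induction t <;> simp_all [ATerm.substAll, ATerm.val]

theorem liftSub_val (σ : ℕ → ATerm) (ρ : ℕ → ℕ) (a : ℕ) :
    (fun n => (liftSub σ n).val (consEnv a ρ)) = consEnv a (fun n => (σ n).val ρ) := by
  funext n
  cases n with
  | zero => rfl
  | succ n => exact term_val_lift (σ n) a ρ

theorem sat_subst (φ : AFml) : ∀ (σ : ℕ → ATerm) (ρ : ℕ → ℕ),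
    (φ.substAll σ).Sat ρ ↔ φ.Sat (fun n => (σ n).val ρ) := by
  induction φ <;> intro σ ρ <;> simp_all [AFml.substAll, AFml.Sat, term_val_subst, liftSub_val]

theorem term_val_agree (t : ATerm) (c : ℕ) (ρ ρ' : ℕ → ℕ) (hρ : ∀ n < c, ρ n = ρ' n)
    (h : t.FreeLt c) : t.val ρ = t.val ρ' := by
  induction t <;> simp_all [ATerm.val, ATerm.FreeLt]

theorem cons_agree (c a : ℕ) (ρ ρ' : ℕ → ℕ) (hρ : ∀ n < c, ρ n = ρ' n) :
    ∀ n < c + 1, consEnv a ρ n = consEnv a ρ' n := by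
  intro n hn
  cases n with
  | zero => rfl
  | succ n => exact hρ n (by omega)

theorem sat_agree (φ : AFml) : ∀ (c : ℕ) (ρ ρ' : ℕ → ℕ), (∀ n < c, ρ n = ρ' n) →
    φ.FreeLt c → (φ.Sat ρ ↔ φ.Sat ρ') := by
  induction φ with
  | eq t s =>
    intro c ρ ρ' hρ h
    simp [AFml.Sat, term_val_agree _ c ρ ρ' hρ h.1, term_val_agree _ c ρ ρ' hρ h.2]
  | le t s =>
    intro c ρ ρ' hρ h
    simp [AFml.Sat, term_val_agree _ c ρ ρ' hρ h.1, term_val_agree _ c ρ ρ' hρ h.2]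
  | neg φ ih => intro c ρ ρ' hρ h; exact not_congr (ih c ρ ρ' hρ h)
  | and φ ψ ih1 ih2 => intro c ρ ρ' hρ h; exact and_congr (ih1 c ρ ρ' hρ h.1) (ih2 c ρ ρ' hρ h.2)
  | or φ ψ ih1 ih2 => intro c ρ ρ' hρ h; exact or_congr (ih1 c ρ ρ' hρ h.1) (ih2 c ρ ρ' hρ h.2)
  | imp φ ψ ih1 ih2 => intro c ρ ρ' hρ h; exact imp_congr (ih1 c ρ ρ' hρ h.1) (ih2 c ρ ρ' hρ h.2)
  | all φ ih =>
    intro c ρ ρ' hρ h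
    exact forall_congr' fun a => ih (c+1) _ _ (cons_agree c a ρ ρ' hρ) h
  | ex φ ih =>
    intro c ρ ρ' hρ h
    exact exists_congr fun a => ih (c+1) _ _ (cons_agree c a ρ ρ' hρ) h

/-! ### The arithmetical hierarchy is closed under substitution -/

theorem delta0_subst {φ : AFml} (h : IsDelta0 φ) : ∀ σ, IsDelta0 (φ.substAll σ) := by
  induction h with
  | eq t s => intro σ; exact .eq _ _
  | le t s => intro σ; exact .le _ _
  | neg _ ih => intro σ; exact .neg (ih σ)
  | and _ _ ih1 ih2 => intro σ; exact .and (ih1 σ) (ih2 σ)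
  | or _ _ ih1 ih2 => intro σ; exact .or (ih1 σ) (ih2 σ)
  | imp _ _ ih1 ih2 => intro σ; exact .imp (ih1 σ) (ih2 σ)
  | ball t _ ih =>
    intro σ
    simp only [AFml.substAll, ATerm.substAll, term_lift_liftSub]
    exact .ball _ (ih _)
  | bex t _ ih =>
    intro σ
    simp only [AFml.substAll, ATerm.substAll, term_lift_liftSub]
    exact .bex _ (ih _)

mutual
theorem sigma1_subst {φ : AFml} (h : IsSigma1 φ) (σ : ℕ → ATerm) : IsSigma1 (φ.substAll σ) := by
  cases h with
  | delta0 h => exact .delta0 (delta0_subst h σ)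
  | and h1 h2 => exact .and (sigma1_subst h1 σ) (sigma1_subst h2 σ)
  | or h1 h2 => exact .or (sigma1_subst h1 σ) (sigma1_subst h2 σ)
  | ex h => exact .ex (sigma1_subst h _)
  | negPi h => exact .negPi (pi1_subst h σ)
  | impPiSigma h1 h2 => exact .impPiSigma (pi1_subst h1 σ) (sigma1_subst h2 σ)
theorem pi1_subst {φ : AFml} (h : IsPi1 φ) (σ : ℕ → ATerm) : IsPi1 (φ.substAll σ) := by
  cases h with
  | delta0 h => exact .delta0 (delta0_subst h σ)
  | and h1 h2 => exact .and (pi1_subst h1 σ) (pi1_subst h2 σ)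
  | or h1 h2 => exact .or (pi1_subst h1 σ) (pi1_subst h2 σ)
  | all h => exact .all (pi1_subst h _)
  | negSigma h => exact .negSigma (sigma1_subst h σ)
  | impSigmaPi h1 h2 => exact .impSigmaPi (sigma1_subst h1 σ) (pi1_subst h2 σ)
end

/-! ### Derived rules -/

theorem proves_mono {Γ Δ : Set AFml} (h : Γ ⊆ Δ) {φ : AFml} (hp : Proves Γ φ) : Proves Δ φ := by
  induction hp with
  | ax h' => exact .ax (h h')
  | taut h => exact .taut h
  | mp _ _ ih1 ih2 => exact .mp ih1 ih2
  | allE φ t => exact .allE φ t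
  | exI φ t => exact .exI φ t
  | allImp φ ψ => exact .allImp φ ψ
  | vacAll φ => exact .vacAll φ
  | exDef φ => exact .exDef φ
  | gen _ ih => exact .gen ih
  | eqRefl t => exact .eqRefl t
  | eqSubst φ t s => exact .eqSubst φ t s

theorem tc1 {Γ : Set AFml} {φ ψ : AFml} (h : Proves Γ φ)
    (ht : ∀ v, φ.evalProp v → ψ.evalProp v) : Proves Γ ψ :=
  .mp (.taut (φ := .imp φ ψ) ht) h

theorem tc2 {Γ : Set AFml} {φ₁ φ₂ ψ : AFml} (h1 : Proves Γ φ₁) (h2 : Proves Γ φ₂)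
    (ht : ∀ v, φ₁.evalProp v → φ₂.evalProp v → ψ.evalProp v) : Proves Γ ψ :=
  .mp (.mp (.taut (φ := .imp φ₁ (.imp φ₂ ψ)) ht) h1) h2

theorem tc3 {Γ : Set AFml} {φ₁ φ₂ φ₃ ψ : AFml} (h1 : Proves Γ φ₁) (h2 : Proves Γ φ₂)
    (h3 : Proves Γ φ₃)
    (ht : ∀ v, φ₁.evalProp v → φ₂.evalProp v → φ₃.evalProp v → ψ.evalProp v) : Proves Γ ψ :=
  .mp (.mp (.mp (.taut (φ := .imp φ₁ (.imp φ₂ (.imp φ₃ ψ))) ht) h1) h2) h3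

theorem imp_trans {Γ : Set AFml} {φ ψ χ : AFml} (h1 : Proves Γ (.imp φ ψ))
    (h2 : Proves Γ (.imp ψ χ)) : Proves Γ (.imp φ χ) :=
  tc2 h1 h2 fun _ a b c => b (a c)

theorem explode {Γ : Set AFml} {φ : AFml} (ψ : AFml) (h1 : Proves Γ φ)
    (h2 : Proves Γ (.neg φ)) : Proves Γ ψ :=
  tc2 h1 h2 fun _ a b => absurd a b

theorem inst {Γ : Set AFml} {φ : AFml} (h : Proves Γ (.all φ)) (t : ATerm) :
    Proves Γ (φ.subst0 t) := .mp (.allE φ t) h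

theorem ex_elim {Γ : Set AFml} {φ ψ : AFml} (h : Proves Γ (.imp φ (AFml.lift 0 ψ))) :
    Proves Γ (.imp (.ex φ) ψ) := by
  have h1 : Proves Γ (.imp (AFml.lift 0 (.neg ψ)) (.neg φ)) := tc1 h fun _ a b c => b (a c)
  have h2 := Proves.mp (.allImp _ _) (.gen h1)
  have h3 := imp_trans (.vacAll (.neg ψ)) h2
  exact tc2 h3 (.exDef φ) fun v a b c => by
    by_contra hc
    exact b.1 c (a hc)

theorem eq_symm {Γ : Set AFml} (t s : ATerm) : Proves Γ (.imp (.eq t s) (.eq s t)) := by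
  have h := Proves.eqSubst (Γ := Γ) (.eq (.var 0) (t.lift 0)) t s
  simp only [AFml.subst0, AFml.substAll, ATerm.substAll, term_lift_subst0, subst0Env] at h
  exact tc2 h (.eqRefl t) fun _ a b c => a c b

theorem eq_trans_imp {Γ : Set AFml} (t s u : ATerm) :
    Proves Γ (.imp (.eq t s) (.imp (.eq s u) (.eq t u))) := by
  have h := Proves.eqSubst (Γ := Γ) (.eq (t.lift 0) (.var 0)) s u
  simp only [AFml.subst0, AFml.substAll, ATerm.substAll, term_lift_subst0, subst0Env] at h
  exact tc1 h fun _ a b c => a c b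

theorem eq_trans' {Γ : Set AFml} {t s u : ATerm} (h1 : Proves Γ (.eq t s))
    (h2 : Proves Γ (.eq s u)) : Proves Γ (.eq t u) :=
  .mp (.mp (eq_trans_imp t s u) h1) h2

theorem eq_symm' {Γ : Set AFml} {t s : ATerm} (h : Proves Γ (.eq t s)) : Proves Γ (.eq s t) :=
  .mp (eq_symm t s) h

theorem eq_succ {Γ : Set AFml} {t s : ATerm} (h : Proves Γ (.eq t s)) :
    Proves Γ (.eq (.succ t) (.succ s)) := by
  have h' := Proves.eqSubst (Γ := Γ) (.eq ((ATerm.succ t).lift 0) (.succ (.var 0))) t s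
  simp only [AFml.subst0, AFml.substAll, term_lift_subst0, ATerm.substAll, subst0Env] at h'
  exact .mp (.mp h' h) (.eqRefl _)

theorem eq_add {Γ : Set AFml} {t s t' s' : ATerm} (h : Proves Γ (.eq t t'))
    (h2 : Proves Γ (.eq s s')) : Proves Γ (.eq (.add t s) (.add t' s')) := by
  have h' := Proves.eqSubst (Γ := Γ) (.eq ((ATerm.add t s).lift 0) (.add (.var 0) (s.lift 0))) t t'
  have h'' := Proves.eqSubst (Γ := Γ) (.eq ((ATerm.add t s).lift 0) (.add (t'.lift 0) (.var 0))) s s'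
  simp only [AFml.subst0, AFml.substAll, term_lift_subst0, ATerm.substAll, subst0Env] at h' h''
  exact .mp (.mp h'' h2) (.mp (.mp h' h) (.eqRefl _))

theorem eq_mul {Γ : Set AFml} {t s t' s' : ATerm} (h : Proves Γ (.eq t t'))
    (h2 : Proves Γ (.eq s s')) : Proves Γ (.eq (.mul t s) (.mul t' s')) := by
  have h' := Proves.eqSubst (Γ := Γ) (.eq ((ATerm.mul t s).lift 0) (.mul (.var 0) (s.lift 0))) t t'
  have h'' := Proves.eqSubst (Γ := Γ) (.eq ((ATerm.mul t s).lift 0) (.mul (t'.lift 0) (.var 0))) s s'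
  simp only [AFml.subst0, AFml.substAll, term_lift_subst0, ATerm.substAll, subst0Env] at h' h''
  exact .mp (.mp h'' h2) (.mp (.mp h' h) (.eqRefl _))

/-! ### Basic arithmetic in PA -/

theorem pa_succ_ne (t : ATerm) : Proves PA (.neg (.eq (.succ t) .zero)) := by
  have h := inst (Γ := PA) (.ax PAax.succNeZero) t
  simpa only [AFml.subst0, AFml.substAll, ATerm.substAll, subst0Env] using h

theorem pa_succ_inj (t s : ATerm) :
    Proves PA (.imp (.eq (.succ t) (.succ s)) (.eq t s)) := by
  have h := inst (Γ := PA) (inst (Γ := PA) (.ax PAax.succInj) t) s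
  simpa only [AFml.subst0, AFml.substAll, ATerm.substAll, subst0Env, liftSub,
    term_lift_subst0] using h

theorem pa_add_zero (t : ATerm) : Proves PA (.eq (.add t .zero) t) := by
  have h := inst (Γ := PA) (.ax PAax.addZero) t
  simpa only [AFml.subst0, AFml.substAll, ATerm.substAll, subst0Env] using h

theorem pa_add_succ (t s : ATerm) :
    Proves PA (.eq (.add t (.succ s)) (.succ (.add t s))) := by
  have h := inst (Γ := PA) (inst (Γ := PA) (.ax PAax.addSucc) t) s
  simpa only [AFml.subst0, AFml.substAll, ATerm.substAll, subst0Env, liftSub,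
    term_lift_subst0] using h

theorem pa_mul_zero (t : ATerm) : Proves PA (.eq (.mul t .zero) .zero) := by
  have h := inst (Γ := PA) (.ax PAax.mulZero) t
  simpa only [AFml.subst0, AFml.substAll, ATerm.substAll, subst0Env] using h

theorem pa_mul_succ (t s : ATerm) :
    Proves PA (.eq (.mul t (.succ s)) (.add (.mul t s) t)) := by
  have h := inst (Γ := PA) (inst (Γ := PA) (.ax PAax.mulSucc) t) s
  simpa only [AFml.subst0, AFml.substAll, ATerm.substAll, subst0Env, liftSub,
    term_lift_subst0] using h

theorem pa_le (t s : ATerm) :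
    Proves PA (iffF (.le t s) (.ex (.eq (.add (.var 0) (t.lift 0)) (s.lift 0)))) := by
  have h := inst (Γ := PA) (inst (Γ := PA) (.ax PAax.leDef) t) s
  simp only [AFml.subst0, iffF, AFml.substAll, ATerm.substAll, subst0Env, liftSub,
    term_lift_subst0, term_lift_liftSub, ATerm.lift] at h
  exact h

theorem pa_le_intro (u t s : ATerm) :
    Proves PA (.imp (.eq (.add u t) s) (.le t s)) := by
  have h := Proves.exI (Γ := PA) (.eq (.add (.var 0) (t.lift 0)) (s.lift 0)) u
  simp only [AFml.subst0, AFml.substAll, ATerm.substAll, subst0Env, term_lift_subst0] at h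
  exact tc2 h (pa_le t s) fun _ a b c => b.2 (a c)

theorem pa_le_elim {t s : ATerm} {ψ : AFml}
    (h : Proves PA (.imp (.eq (.add (.var 0) (t.lift 0)) (s.lift 0)) (AFml.lift 0 ψ))) :
    Proves PA (.imp (.le t s) ψ) :=
  tc2 (ex_elim h) (pa_le t s) fun _ a b c => a (b.1 c)

theorem pa_le_of_succ (t s : ATerm) :
    Proves PA (.imp (.le (.succ t) (.succ s)) (.le t s)) := by
  apply pa_le_elim
  simp only [AFml.lift, ATerm.lift]
  have h1 := pa_add_succ (.var 0) (t.lift 0)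
  have h2 := eq_trans_imp (Γ := PA) (.succ (.add (.var 0) (t.lift 0)))
    (.add (.var 0) (.succ (t.lift 0))) (.succ (s.lift 0))
  have h3 := Proves.mp h2 (eq_symm' h1)
  exact imp_trans (imp_trans h3 (pa_succ_inj _ _)) (pa_le_intro _ _ _)

theorem pa_not_succ_le (t : ATerm) : Proves PA (.neg (.le (.succ t) .zero)) := by
  have h : Proves PA (.imp (.le (.succ t) .zero) (.eq (.succ .zero) .zero)) := by
    apply pa_le_elim
    simp only [AFml.lift, ATerm.lift]
    have h1 := pa_add_succ (.var 0) (t.lift 0)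
    have h2 := eq_trans_imp (Γ := PA) (.succ (.add (.var 0) (t.lift 0)))
      (.add (.var 0) (.succ (t.lift 0))) .zero
    have h3 := Proves.mp h2 (eq_symm' h1)
    exact tc2 h3 (pa_succ_ne (.add (.var 0) (t.lift 0))) fun _ a b c => absurd (a c) b
  exact tc2 h (pa_succ_ne .zero) fun _ a b c => b (a c)

theorem num_add (a b : ℕ) :
    Proves PA (.eq (.add (numeral a) (numeral b)) (numeral (a + b))) := by
  induction b with
  | zero => exact pa_add_zero _
  | succ b ih => exact eq_trans' (pa_add_succ _ _) (eq_succ ih)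

theorem num_mul (a b : ℕ) :
    Proves PA (.eq (.mul (numeral a) (numeral b)) (numeral (a * b))) := by
  induction b with
  | zero => exact pa_mul_zero _
  | succ b ih => exact eq_trans' (eq_trans' (pa_mul_succ _ _) (eq_add ih (.eqRefl _))) (num_add _ _)

theorem num_le {a b : ℕ} (h : a ≤ b) : Proves PA (.le (numeral a) (numeral b)) := by
  have h1 := num_add (b - a) a
  rw [Nat.sub_add_cancel h] at h1
  exact .mp (pa_le_intro _ _ _) h1

theorem num_not_le : ∀ {a b : ℕ}, ¬ a ≤ b → Proves PA (.neg (.le (numeral a) (numeral b)))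
  | 0, _, h => absurd (Nat.zero_le _) h
  | _ + 1, 0, _ => pa_not_succ_le _
  | a + 1, b + 1, h => tc2 (num_not_le (a := a) (b := b) (by omega))
      (pa_le_of_succ (numeral a) (numeral b)) fun _ x y z => x (y z)

theorem num_ne : ∀ {a b : ℕ}, ¬ a = b → Proves PA (.neg (.eq (numeral a) (numeral b)))
  | 0, 0, h => absurd rfl h
  | _ + 1, 0, _ => pa_succ_ne _
  | 0, b + 1, _ => tc2 (pa_succ_ne (numeral b)) (eq_symm .zero (.succ (numeral b)))
      fun _ x y z => x (y z)
  | a + 1, b + 1, h => tc2 (num_ne (a := a) (b := b) (by omega))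
      (pa_succ_inj (numeral a) (numeral b)) fun _ x y z => x (y z)

/-- Bounded universal statements follow from their numeral instances. -/
theorem bounded_all (k : ℕ) : ∀ φ : AFml, (∀ i ≤ k, Proves PA (φ.subst0 (numeral i))) →
    Proves PA (.all (.imp (.le (.var 0) (numeral k)) φ)) := by
  induction k with
  | zero =>
    intro φ h
    have h1 : Proves PA ((AFml.imp (.le (.var 0) (numeral 0)) φ).subst0 .zero) :=
      tc1 (h 0 le_rfl) fun _ a _ => a
    have h2 : Proves PA (.all (.imp (AFml.imp (.le (.var 0) (numeral 0)) φ)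
        (succSubst (AFml.imp (.le (.var 0) (numeral 0)) φ)))) := by
      apply Proves.gen
      simp only [succSubst, AFml.substAll, ATerm.substAll, numeral]
      exact tc1 (pa_not_succ_le (.var 0)) fun _ a _ c => absurd c a
    exact .mp (.ax (PAax.ind _)) (tc2 h1 h2 fun _ a b => ⟨a, b⟩)
  | succ k ih =>
    intro φ h
    have h1 : Proves PA ((AFml.imp (.le (.var 0) (numeral (k + 1))) φ).subst0 .zero) :=
      tc1 (h 0 (Nat.zero_le _)) fun _ a _ => a
    have h2 : Proves PA (.all (.imp (AFml.imp (.le (.var 0) (numeral (k + 1))) φ)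
        (succSubst (AFml.imp (.le (.var 0) (numeral (k + 1))) φ)))) := by
      have h3 := ih (succSubst φ) (by
        intro i hi
        have := h (i + 1) (by omega)
        unfold AFml.subst0 succSubst at *
        rw [fml_subst_comp]
        convert this using 2
        funext n
        cases n <;> simp [subst0Env, ATerm.substAll, numeral])
      refine .mp (.mp (.allImp _ _) (.gen ?_)) h3
      refine tc1 (pa_le_of_succ (.var 0) (numeral k)) ?_
      simp only [succSubst, AFml.substAll, ATerm.substAll, numeral_subst, numeral, if_true]
      exact fun _ a b _ c => b (a c)
    exact .mp (.ax (PAax.ind _)) (tc2 h1 h2 fun _ a b => ⟨a, b⟩)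

/-! ### Σ₁-completeness of PA -/

/-- The substitution of numerals given by an environment. -/
def numEnv (ρ : ℕ → ℕ) : ℕ → ATerm := fun n => numeral (ρ n)

theorem term_numEnv_lift (t : ATerm) (ρ : ℕ → ℕ) (c : ℕ) :
    (t.substAll (numEnv ρ)).lift c = t.substAll (numEnv ρ) := by
  induction t <;> simp_all [ATerm.substAll, ATerm.lift, numEnv, numeral_lift]

theorem term_eval (t : ATerm) (ρ : ℕ → ℕ) :
    Proves PA (.eq (t.substAll (numEnv ρ)) (numeral (t.val ρ))) := by
  induction t with
  | var n => exact .eqRefl _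
  | zero => exact .eqRefl _
  | succ t ih => exact eq_succ ih
  | add t s ih1 ih2 => exact eq_trans' (eq_add ih1 ih2) (num_add _ _)
  | mul t s ih1 ih2 => exact eq_trans' (eq_mul ih1 ih2) (num_mul _ _)

theorem subst0_numEnv (φ : AFml) (ρ : ℕ → ℕ) (a : ℕ) :
    (φ.substAll (liftSub (numEnv ρ))).subst0 (numeral a) = φ.substAll (numEnv (consEnv a ρ)) := by
  unfold AFml.subst0
  rw [fml_subst_comp]
  congr 1
  funext n
  cases n with
  | zero => rfl
  | succ n => exact term_lift_subst0 _ _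

theorem le_eval_right (u : ATerm) {t s : ATerm} (h : Proves PA (.eq t s)) :
    Proves PA (.imp (.le u t) (.le u s)) := by
  have h' := Proves.eqSubst (Γ := PA) (.le (u.lift 0) (.var 0)) t s
  simp only [AFml.subst0, AFml.substAll, ATerm.substAll, term_lift_subst0, subst0Env] at h'
  exact .mp h' h

theorem le_eval_left (u : ATerm) {t s : ATerm} (h : Proves PA (.eq t s)) :
    Proves PA (.imp (.le t u) (.le s u)) := by
  have h' := Proves.eqSubst (Γ := PA) (.le (.var 0) (u.lift 0)) t s
  simp only [AFml.subst0, AFml.substAll, ATerm.substAll, term_lift_subst0, subst0Env] at h'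
  exact .mp h' h

theorem delta0_complete {φ : AFml} (h : IsDelta0 φ) : ∀ ρ : ℕ → ℕ,
    (φ.Sat ρ → Proves PA (φ.substAll (numEnv ρ))) ∧
    (¬ φ.Sat ρ → Proves PA (.neg (φ.substAll (numEnv ρ)))) := by
  induction h with
  | eq t s =>
    intro ρ
    have ht := term_eval t ρ
    have hs := term_eval s ρ
    refine ⟨fun h => ?_, fun h => ?_⟩
    · have h' : t.val ρ = s.val ρ := h
      rw [← h'] at hs
      exact eq_trans' ht (eq_symm' hs)
    · have h1 := num_ne (a := t.val ρ) (b := s.val ρ) h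
      have h2 := Proves.mp (eq_trans_imp _ _ (s.substAll (numEnv ρ))) (eq_symm' ht)
      have h3 := eq_trans_imp (Γ := PA) (numeral (t.val ρ)) (s.substAll (numEnv ρ)) (numeral (s.val ρ))
      have h4 := imp_trans h2 h3
      exact tc3 h1 h4 hs fun _ a b c d => a (b d c)
  | le t s =>
    intro ρ
    have ht := term_eval t ρ
    have hs := term_eval s ρ
    refine ⟨fun h => ?_, fun h => ?_⟩
    · exact .mp (le_eval_right _ (eq_symm' hs)) (.mp (le_eval_left _ (eq_symm' ht)) (num_le h))
    · have h1 := num_not_le (a := t.val ρ) (b := s.val ρ) h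
      have h2 := imp_trans (le_eval_left (s.substAll (numEnv ρ)) ht)
        (le_eval_right (numeral (t.val ρ)) hs)
      exact tc2 h1 h2 fun _ a b c => a (b c)
  | neg _ ih =>
    intro ρ
    refine ⟨fun h => (ih ρ).2 h, fun h => ?_⟩
    exact tc1 ((ih ρ).1 (not_not.1 h)) fun _ a b => b a
  | and _ _ ih1 ih2 =>
    intro ρ
    refine ⟨fun h => tc2 ((ih1 ρ).1 h.1) ((ih2 ρ).1 h.2) fun _ a b => ⟨a, b⟩, fun h => ?_⟩
    rcases not_and_or.1 h with h | h
    · exact tc1 ((ih1 ρ).2 h) fun _ a b => a b.1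
    · exact tc1 ((ih2 ρ).2 h) fun _ a b => a b.2
  | or _ _ ih1 ih2 =>
    intro ρ
    refine ⟨fun h => ?_, fun h => ?_⟩
    · rcases h with h | h
      · exact tc1 ((ih1 ρ).1 h) fun _ a => Or.inl a
      · exact tc1 ((ih2 ρ).1 h) fun _ a => Or.inr a
    · have h' := not_or.1 h
      exact tc2 ((ih1 ρ).2 h'.1) ((ih2 ρ).2 h'.2) fun _ a b c => c.elim a b
  | @imp φ ψ _ _ ih1 ih2 =>
    intro ρ
    refine ⟨fun h => ?_, fun h => ?_⟩
    · by_cases h1 : φ.Sat ρ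
      · exact tc1 ((ih2 ρ).1 (h h1)) fun _ a _ => a
      · exact tc1 ((ih1 ρ).2 h1) fun _ a b => absurd b a
    · have h' := Classical.not_imp.1 h
      exact tc2 ((ih1 ρ).1 h'.1) ((ih2 ρ).2 h'.2) fun _ a b c => b (c a)
  | @ball φ t _ ih =>
    intro ρ
    have ht := term_eval t ρ
    have e : (AFml.all (.imp (.le (.var 0) (ATerm.lift 0 t)) φ)).substAll (numEnv ρ)
        = .all (.imp (.le (.var 0) (t.substAll (numEnv ρ))) (φ.substAll (liftSub (numEnv ρ)))) := by
      simp only [AFml.substAll, ATerm.substAll, term_lift_liftSub, term_numEnv_lift]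
      rfl
    rw [e]
    refine ⟨fun h => ?_, fun h => ?_⟩
    · have h1 := bounded_all (t.val ρ) (φ.substAll (liftSub (numEnv ρ))) (by
        intro i hi
        rw [subst0_numEnv]
        refine (ih _).1 (h i ?_)
        simpa [AFml.Sat, ATerm.val, term_val_lift, consEnv] using hi)
      refine .mp (.mp (.allImp _ _) (.gen ?_)) h1
      exact tc1 (le_eval_right (.var 0) ht) fun _ a b c => b (a c)
    · simp only [AFml.Sat, ATerm.val, term_val_lift, consEnv, not_forall] at h
      obtain ⟨a, ha, hn⟩ := h
      have h1 := (ih _).2 hn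
      rw [← subst0_numEnv] at h1
      have h2 := Proves.mp (le_eval_right _ (eq_symm' ht)) (num_le ha)
      have h3 := Proves.allE (Γ := PA)
        (.imp (.le (.var 0) (t.substAll (numEnv ρ))) (φ.substAll (liftSub (numEnv ρ)))) (numeral a)
      have e2 : (t.substAll (numEnv ρ)).substAll (subst0Env (numeral a)) = t.substAll (numEnv ρ) := by
        conv_lhs => rw [← term_numEnv_lift t ρ 0]
        exact term_lift_subst0 _ _
      simp only [AFml.subst0, AFml.substAll, ATerm.substAll, subst0Env, e2] at h1 h3
      exact tc3 h1 h2 h3 fun _ x y z w => x (z w y)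
  | @bex φ t _ ih =>
    intro ρ
    have ht := term_eval t ρ
    have e : (AFml.ex (.and (.le (.var 0) (ATerm.lift 0 t)) φ)).substAll (numEnv ρ)
        = .ex (.and (.le (.var 0) (t.substAll (numEnv ρ))) (φ.substAll (liftSub (numEnv ρ)))) := by
      simp only [AFml.substAll, ATerm.substAll, term_lift_liftSub, term_numEnv_lift]
      rfl
    rw [e]
    refine ⟨fun h => ?_, fun h => ?_⟩
    · simp only [AFml.Sat, ATerm.val, term_val_lift, consEnv] at h
      obtain ⟨a, ha, hn⟩ := h
      have h1 := (ih _).1 hn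
      rw [← subst0_numEnv] at h1
      have h2 := Proves.mp (le_eval_right _ (eq_symm' ht)) (num_le ha)
      have h3 := Proves.exI (Γ := PA)
        (.and (.le (.var 0) (t.substAll (numEnv ρ))) (φ.substAll (liftSub (numEnv ρ)))) (numeral a)
      have e2 : (t.substAll (numEnv ρ)).substAll (subst0Env (numeral a)) = t.substAll (numEnv ρ) := by
        conv_lhs => rw [← term_numEnv_lift t ρ 0]
        exact term_lift_subst0 _ _
      simp only [AFml.subst0, AFml.substAll, ATerm.substAll, subst0Env, e2] at h1 h3
      exact tc3 h1 h2 h3 fun _ x y z => z ⟨y, x⟩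
    · have h1 := bounded_all (t.val ρ) (.neg (φ.substAll (liftSub (numEnv ρ)))) (by
        intro i hi
        have e3 := subst0_numEnv φ ρ i
        simp only [AFml.subst0] at e3
        simp only [AFml.subst0, AFml.substAll, e3]
        refine (ih _).2 fun hs => h ⟨i, ?_, hs⟩
        simpa [AFml.Sat, ATerm.val, term_val_lift, consEnv] using hi)
      have h2 : Proves PA (.all (.neg (.and (.le (.var 0) (t.substAll (numEnv ρ)))
          (φ.substAll (liftSub (numEnv ρ)))))) := by
        refine .mp (.mp (.allImp _ _) (.gen ?_)) h1
        exact tc1 (le_eval_right (.var 0) ht) fun _ a b c => b (a c.1) c.2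
      exact tc2 h2 (.exDef _) fun _ a b c => b.1 c a

mutual
theorem sigma1_complete' {φ : AFml} (h : IsSigma1 φ) (ρ : ℕ → ℕ) (hs : φ.Sat ρ) :
    Proves PA (φ.substAll (numEnv ρ)) := by
  cases h with
  | delta0 h => exact (delta0_complete h ρ).1 hs
  | and h1 h2 =>
    exact tc2 (sigma1_complete' h1 ρ hs.1) (sigma1_complete' h2 ρ hs.2) fun _ a b => ⟨a, b⟩
  | or h1 h2 =>
    rcases hs with hs | hs
    · exact tc1 (sigma1_complete' h1 ρ hs) fun _ a => Or.inl a
    · exact tc1 (sigma1_complete' h2 ρ hs) fun _ a => Or.inr a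
  | ex h =>
    obtain ⟨a, ha⟩ := hs
    have h1 := sigma1_complete' h _ ha
    rw [← subst0_numEnv] at h1
    exact .mp (.exI _ _) h1
  | negPi h => exact pi1_complete' h ρ hs
  | @impPiSigma φ ψ h1 h2 =>
    by_cases hp : φ.Sat ρ
    · exact tc1 (sigma1_complete' h2 ρ (hs hp)) fun _ a _ => a
    · exact tc1 (pi1_complete' h1 ρ hp) fun _ a b => absurd b a
theorem pi1_complete' {φ : AFml} (h : IsPi1 φ) (ρ : ℕ → ℕ) (hs : ¬ φ.Sat ρ) :
    Proves PA (.neg (φ.substAll (numEnv ρ))) := by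
  cases h with
  | delta0 h => exact (delta0_complete h ρ).2 hs
  | and h1 h2 =>
    rcases not_and_or.1 hs with hs | hs
    · exact tc1 (pi1_complete' h1 ρ hs) fun _ a b => a b.1
    · exact tc1 (pi1_complete' h2 ρ hs) fun _ a b => a b.2
  | or h1 h2 =>
    have hs' := not_or.1 hs
    exact tc2 (pi1_complete' h1 ρ hs'.1) (pi1_complete' h2 ρ hs'.2) fun _ a b c => c.elim a b
  | all h =>
    obtain ⟨a, ha⟩ := not_forall.1 hs
    have h1 := pi1_complete' h _ ha
    rw [← subst0_numEnv] at h1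
    exact tc2 h1 (.allE _ (numeral a)) fun _ x y z => x (y z)
  | negSigma h => exact tc1 (sigma1_complete' h ρ (not_not.1 hs)) fun _ a b => b a
  | impSigmaPi h1 h2 =>
    have hs' := Classical.not_imp.1 hs
    exact tc2 (sigma1_complete' h1 ρ hs'.1) (pi1_complete' h2 ρ hs'.2) fun _ a b c => b (c a)
end

/-- Every true `Σ₁` sentence is provable in PA. -/
theorem sigma1_complete {φ : AFml} (h : IsSigma1 φ) (hf : φ.FreeLt 0) (ht : TrueN φ) :
    Proves PA φ := by
  have := sigma1_complete' h _ ht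
  rwa [fml_subst_id φ 0 _ (by simp) hf] at this

/-! ### The self-referential sentence -/

def bexF (t : ATerm) (φ : AFml) : AFml := .ex (.and (.le (.var 0) (ATerm.lift 0 t)) φ)
def ballF (t : ATerm) (φ : AFml) : AFml := .all (.imp (.le (.var 0) (ATerm.lift 0 t)) φ)

/-- `a mod ((i+1)*b+1) = r`. -/
def betaF (a b i r : ATerm) : AFml :=
  .and (.le r (.mul (.succ i) b))
    (bexF a (.eq (ATerm.lift 0 a)
      (.add (.mul (.succ (.mul (.succ (ATerm.lift 0 i)) (ATerm.lift 0 b))) (.var 0))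
        (ATerm.lift 0 r))))

theorem betaF_delta0 (a b i r : ATerm) : IsDelta0 (betaF a b i r) :=
  .and (.le _ _) (.bex _ (.eq _ _))

theorem mod_iff (a m r : ℕ) : (r ≤ m ∧ ∃ q ≤ a, a = (m + 1) * q + r) ↔ a % (m + 1) = r := by
  constructor
  · rintro ⟨h, q, _, rfl⟩
    rw [Nat.mul_add_mod, Nat.mod_eq_of_lt (by omega)]
  · rintro rfl
    exact ⟨Nat.lt_succ_iff.1 (Nat.mod_lt _ (by omega)), a / (m + 1), Nat.div_le_self _ _,
      (Nat.div_add_mod _ _).symm⟩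

theorem betaF_sat (a b i r : ATerm) (ρ : ℕ → ℕ) : (betaF a b i r).Sat ρ ↔
    a.val ρ % ((i.val ρ + 1) * b.val ρ + 1) = r.val ρ := by
  rw [← mod_iff]
  simp [betaF, bexF, AFml.Sat, ATerm.val, term_val_lift, consEnv]

theorem betaF_free (a b i r : ATerm) (d : ℕ) (ha : a.FreeLt d) (hb : b.FreeLt d) (hi : i.FreeLt d)
    (hr : r.FreeLt d) : (betaF a b i r).FreeLt d := by
  simp [betaF, bexF, AFml.FreeLt, ATerm.FreeLt, term_free_lift, ha, hb, hi, hr]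

def sqT (t : ATerm) : ATerm := .mul t t

/-- The code of `¬∃x(x = n̄ ∧ φ)`, where `c` is the code of `n̄` and `n` the code of `φ`. -/
def diagT (c n : ATerm) : ATerm :=
  .add (sqT (.add (sqT (.add (sqT (.add (.add (sqT (sqT (sqT c))) (sqT (sqT c))) n)) (numeral 3)))
    (numeral 7))) (numeral 2)

/-- Matrix: `var 0 = y`, `var 1 = c`, `var 2 = b`, `var 3 = a`, `var 4 = x`. -/
def matF : AFml :=
  .and (.eq (.var 0) (diagT (.var 1) (.var 4)))
  (.and (betaF (.var 3) (.var 2) (numeral 1) (numeral 8))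
  (.and (betaF (.var 3) (.var 2) (.var 4) (.var 1))
    (ballF (.var 4) (.imp (.le (numeral 1) (.var 0)) (.imp (.le (.succ (.var 0)) (.var 5))
      (bexF (.var 4) (.and (betaF (.var 5) (.var 4) (.var 1) (.var 0))
        (betaF (.var 5) (.var 4) (.succ (.var 1)) (.add (sqT (.var 0)) (numeral 2))))))))))

theorem matF_delta0 : IsDelta0 matF :=
  .and (.eq _ _) (.and (betaF_delta0 _ _ _ _) (.and (betaF_delta0 _ _ _ _)
    (.ball _ (.imp (.le _ _) (.imp (.le _ _)
      (.bex _ (.and (betaF_delta0 _ _ _ _) (betaF_delta0 _ _ _ _))))))))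

theorem matF_free : matF.FreeLt 5 := by
  simp [matF, ballF, bexF, AFml.FreeLt, ATerm.FreeLt, diagT, sqT, numeral_free,
    ATerm.lift]
  refine ⟨?_, ?_, ?_, ?_⟩ <;> apply betaF_free <;> simp [ATerm.FreeLt, numeral_free]

def hF (P : AFml) : AFml := .ex (.ex (.ex (.ex (.and matF P))))

/-- `∃x(x = ⌜H⌝ ∧ H(x))`. -/
def sG (H : AFml) : AFml := .ex (.and (.eq (.var 0) (numeral H.code)) H)

def sF (P : AFml) : AFml := sG (hF P)

theorem sG_sigma1 {H : AFml} (h : IsSigma1 H) : IsSigma1 (sG H) :=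
  .ex (.and (.delta0 (.eq _ _)) h)

theorem sG_free {H : AFml} (h : H.FreeLt 1) : (sG H).FreeLt 0 :=
  ⟨⟨Nat.zero_lt_one, numeral_free _ _⟩, h⟩

theorem sG_true (H : AFml) : TrueN (sG H) ↔ H.Sat (consEnv H.code fun _ => 0) := by
  simp [TrueN, sG, AFml.Sat, ATerm.val, numeral_val, consEnv]

theorem ex_code_pos (φ : AFml) : 1 ≤ (AFml.ex φ).code :=
  le_trans (by norm_num) (Nat.left_le_pair 7 φ.code)

theorem hF_pos (P : AFml) : 1 ≤ (hF P).code := by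
  unfold hF
  exact ex_code_pos _

theorem hF_sat (P : AFml) (ρ : ℕ → ℕ) : (hF P).Sat ρ ↔ ∃ a b c y,
    matF.Sat (consEnv y (consEnv c (consEnv b (consEnv a ρ)))) ∧
    P.Sat (consEnv y (consEnv c (consEnv b (consEnv a ρ)))) := by
  unfold hF
  exact Iff.rfl

theorem hF_sigma1 {P : AFml} (h : IsSigma1 P) : IsSigma1 (hF P) :=
  .ex (.ex (.ex (.ex (.and (.delta0 matF_delta0) h))))

theorem hF_free {P : AFml} (h : P.FreeLt 1) : (hF P).FreeLt 1 :=
  ⟨matF_free, fml_free_mono P 1 5 (by omega) h⟩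

theorem sF_sigma1 {P : AFml} (h : IsSigma1 P) : IsSigma1 (sF P) := sG_sigma1 (hF_sigma1 h)

theorem sF_free {P : AFml} (h : P.FreeLt 1) : (sF P).FreeLt 0 := sG_free (hF_free h)

theorem pair_lt {a b : ℕ} (h : a < b) : Nat.pair a b = b * b + a := by simp [Nat.pair, h]

theorem pair_zero {b : ℕ} (h : 0 < b) : Nat.pair 0 b = b * b := pair_lt h

theorem pair_ge {a b : ℕ} (h : b ≤ a) : Nat.pair a b = a * a + a + b := by
  simp [Nat.pair, Nat.not_lt.2 h]

theorem numcode_one : (numeral 1).code = 8 := by decide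

theorem numcode_succ (k : ℕ) : k + 8 ≤ (numeral (k + 1)).code ∧
    (numeral (k + 2)).code = (numeral (k + 1)).code * (numeral (k + 1)).code + 2 := by
  induction k with
  | zero =>
    rw [show (numeral (0 + 1)).code = 8 from numcode_one]
    exact ⟨by omega, by decide⟩
  | succ k ih =>
    have h : k + 1 + 8 ≤ (numeral (k + 2)).code := by nlinarith [ih.1, ih.2]
    refine ⟨h, ?_⟩
    exact pair_lt (a := 2) (b := (numeral (k + 2)).code) (by omega)

theorem sG_code (H : AFml) (hpos : 1 ≤ H.code) (ρ : ℕ → ℕ) (C N : ℕ)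
    (hc : C = (numeral N).code) (hn : N = H.code) :
    (diagT (.var 0) (.var 1)).val (consEnv C (consEnv N ρ)) = (AFml.neg (sG H)).code := by
  obtain ⟨k, hk⟩ : ∃ k, N = k + 1 := ⟨N - 1, by omega⟩
  have hb := (numcode_succ k).1
  rw [← hk, ← hc] at hb
  simp only [diagT, sqT, ATerm.val, numeral_val, consEnv]
  simp only [AFml.code, sG, ATerm.code]
  rw [← hn, ← hc]
  clear hc hn
  have hC : N < C := by omega
  have h8 : 8 ≤ C := by omega
  have h2 : C ≤ C * C := Nat.le_mul_self C
  have h4 : C * C ≤ (C * C) * (C * C) := Nat.le_mul_self _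
  rw [show Nat.pair 0 0 = 0 from rfl, pair_zero (b := C) (by omega),
    pair_zero (b := C * C) (by omega), pair_ge (b := N) (by omega)]
  generalize hX : C * C * (C * C) = X at *
  have hY0 : 8 ≤ X * X + X + N := by omega
  generalize X * X + X + N = Y at *
  have hY : Y ≤ Y * Y := Nat.le_mul_self Y
  rw [pair_lt (a := 3) (b := Y) (by omega)]
  have hZ0 : 8 ≤ Y * Y + 3 := by omega
  generalize Y * Y + 3 = Z at *
  have hZ : Z ≤ Z * Z := Nat.le_mul_self Z
  rw [pair_lt (a := 7) (b := Z) (by omega), pair_lt (a := 2) (by omega)]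

theorem beta_exists (n : ℕ) : ∃ a b : ℕ, ∀ i ≤ n, a % ((i + 1) * b + 1) = (numeral i).code := by
  let l := (List.range (n + 1)).map (fun i => (numeral i).code)
  refine ⟨(Nat.unbeta l).unpair.1, (Nat.unbeta l).unpair.2, fun i hi => ?_⟩
  have := Nat.beta_unbeta_coe l ⟨i, by simp [l]; omega⟩
  simpa [Nat.beta, l] using this

theorem matF_sat (ρ : ℕ → ℕ) (y c b a x : ℕ) (hx : 1 ≤ x) :
    matF.Sat (consEnv y (consEnv c (consEnv b (consEnv a (consEnv x ρ))))) ↔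
    y = (diagT (.var 0) (.var 1)).val (consEnv c (consEnv x ρ)) ∧
    a % ((1 + 1) * b + 1) = 8 ∧ a % ((x + 1) * b + 1) = c ∧
    ∀ i ≤ x, 1 ≤ i → i + 1 ≤ x → ∃ r ≤ a, a % ((i + 1) * b + 1) = r ∧
      a % ((i + 1 + 1) * b + 1) = r * r + 2 := by
  simp [matF, ballF, bexF, AFml.Sat, betaF_sat, ATerm.val, ATerm.lift, numeral_val, consEnv, diagT,
    sqT]

theorem sG_hF_sat {P : AFml} (N : ℕ) (hpos : 1 ≤ N) (K : ℕ) (ρ : ℕ → ℕ)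
    (hP : P.FreeLt 1)
    (hK : (diagT (.var 0) (.var 1)).val (consEnv (numeral N).code (consEnv N ρ)) = K) :
    (hF P).Sat (consEnv N ρ) ↔ P.Sat (fun _ => K) := by
  have h2 : ∀ ρ y, P.Sat (consEnv y ρ) ↔ P.Sat (fun _ => y) := by
    intro ρ y
    refine sat_agree P 1 _ _ ?_ hP
    intro n hn
    obtain rfl : n = 0 := by omega
    rfl
  rw [hF_sat]
  constructor
  · rintro ⟨a, b, c, y, hm, hp⟩
    rw [matF_sat _ _ _ _ _ _ hpos] at hm
    obtain ⟨hy, h8, hc, hstep⟩ := hm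
    rw [h2] at hp
    have hseq : ∀ i, i + 1 ≤ N → a % ((i + 1 + 1) * b + 1) = (numeral (i + 1)).code := by
      intro i
      induction i with
      | zero => intro _; rw [show (numeral (0 + 1)).code = 8 from numcode_one]; exact h8
      | succ i ih =>
        intro hi
        obtain ⟨r, _, hr1, hr2⟩ := hstep (i + 1) (by omega) (by omega) hi
        rw [hr2, ← hr1, ih (by omega)]
        exact (numcode_succ i).2.symm
    have hC : c = (numeral N).code := by
      obtain ⟨k, hk⟩ : ∃ k, N = k + 1 := ⟨N - 1, by omega⟩
      rw [← hc, hk]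
      exact hseq k (by omega)
    rw [hC, hK] at hy
    rwa [hy] at hp
  · intro hp
    obtain ⟨a, b, hab⟩ := beta_exists N
    refine ⟨a, b, (numeral N).code, K, ?_, ?_⟩
    · rw [matF_sat _ _ _ _ _ _ hpos]
      refine ⟨hK.symm, ?_, hab _ le_rfl, ?_⟩
      · rw [hab 1 hpos, numcode_one]
      · intro i hi h1i hi1
        refine ⟨_, Nat.mod_le _ _, rfl, ?_⟩
        rw [hab i hi, hab (i + 1) hi1]
        obtain ⟨k, rfl⟩ : ∃ k, i = k + 1 := ⟨i - 1, by omega⟩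
        exact (numcode_succ k).2
    · exact (h2 _ _).2 hp

theorem appNum_true {P : AFml} (hP : P.FreeLt 1) (φ : AFml) :
    TrueN (P.appNum φ) ↔ P.Sat (fun _ => φ.code) := by
  unfold TrueN AFml.appNum AFml.subst0
  rw [sat_subst]
  refine sat_agree P 1 _ _ ?_ hP
  intro n hn
  obtain rfl : n = 0 := by omega
  exact numeral_val _ _

theorem sF_true {P : AFml} (hP : P.FreeLt 1) :
    TrueN (sF P) ↔ TrueN (P.appNum (.neg (sF P))) := by
  rw [appNum_true hP]
  unfold sF
  rw [sG_true]
  exact sG_hF_sat _ (hF_pos P) _ _ hP (sG_code _ (hF_pos P) _ _ _ (Eq.refl _) (Eq.refl _))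

/-! ### Interpretations -/

/-- The interpretation sending every variable to `φ`. -/
def interp (P φ : AFml) : MFml → AFml
  | .var _ => φ
  | .bot => botFml
  | .neg A => .neg (interp P φ A)
  | .and A B => .and (interp P φ A) (interp P φ B)
  | .or A B => .or (interp P φ A) (interp P φ B)
  | .imp A B => .imp (interp P φ A) (interp P φ B)
  | .box A => P.appNum (interp P φ A)

theorem interp_isInterp (P φ : AFml) (h : φ.FreeLt 0) : IsInterp P (interp P φ) :=
  ⟨fun _ => h, rfl, fun _ => rfl, fun _ _ => rfl, fun _ _ => rfl, fun _ _ => rfl, fun _ => rfl⟩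

theorem interp_boxIter (P φ : AFml) (A : MFml) (m : ℕ) :
    interp P φ (boxIter m A) = iterPred P m (interp P φ A) := by
  induction m with
  | zero => rfl
  | succ m ih => simp [boxIter, interp, iterPred, ih]

theorem appNum_free {P : AFml} (h : P.FreeLt 1) (φ : AFml) : (P.appNum φ).FreeLt 0 := by
  refine fml_free_subst P 1 0 _ ?_ h
  intro n hn
  obtain rfl : n = 0 := by omega
  exact numeral_free _ _

theorem iter_true {Tax : Set AFml} (hsound : Sigma1Sound Tax) {P : AFml}
    (hS : IsSigma1 P) (hP : IsProvPred Tax P) (φ : AFml) (k : ℕ)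
    (h : TrueN (iterPred P (k + 1) φ)) : Proves Tax φ := by
  induction k with
  | zero =>
    exact (hP.2 _).2 (sigma1_complete (sigma1_subst hS _) (appNum_free hP.1 _) h)
  | succ k ih =>
    have h1 := (hP.2 _).2 (sigma1_complete (sigma1_subst hS _) (appNum_free hP.1 _) h)
    exact ih (hsound _ (sigma1_subst hS _) (appNum_free hP.1 _) h1)

/-- Suppose `T` is `Σ₁`-sound. For each `m ≥ 1`, there exists no `Σ₁`
provability predicate `PR_T(x)` of `T` such that `N⁺A_{m,0} ⊆ PL(PR_T)`. -/
theorem statement_3 (Tax : Set AFml) (hext : PA ⊆ Tax)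
    (hcons : ¬ Proves Tax botFml) (hpr : PrAxiomatized Tax)
    (hsound : Sigma1Sound Tax)
    (m : ℕ) (hm : 1 ≤ m) :
    ¬ ∃ P : AFml, IsSigma1 P ∧ IsProvPred Tax P ∧
        {A : MFml | NAProves m 0 A} ⊆ PL Tax P := by
  rintro ⟨P, hS, hP, hPL⟩
  obtain ⟨k, rfl⟩ : ∃ k, m = k + 1 := ⟨m - 1, by omega⟩
  have hSs := sF_sigma1 hS
  have hSf := sF_free hP.1
  have hbox : ∀ A : MFml, Proves Tax (.imp (interp P (sF P) A)
      (iterPred P (k + 1) (interp P (sF P) A))) := by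
    intro A
    have h := hPL (NAProves.acc (m := k + 1) (n := 0) A) _ (interp_isInterp P (sF P) hSf)
    rwa [interp, interp_boxIter, interp_boxIter] at h
  have h1 := hbox (.var 0)
  have h2 := hbox (.neg (.var 0))
  have h3 : Proves Tax (.or (iterPred P (k + 1) (sF P)) (iterPred P (k + 1) (.neg (sF P)))) :=
    tc2 h1 h2 fun v a b => (em ((sF P).evalProp v)).imp a b
  have h4 := hsound _ (.or (sigma1_subst hS _) (sigma1_subst hS _))
    ⟨appNum_free hP.1 _, appNum_free hP.1 _⟩ h3
  -- both `S` and `¬S` being provable contradicts consistency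
  have hboth : Proves Tax (sF P) ∧ Proves Tax (.neg (sF P)) := by
    rcases h4 with h4 | h4
    · have hp := iter_true hsound hS hP _ k h4
      refine ⟨hp, (hP.2 _).2 ?_⟩
      exact sigma1_complete (sigma1_subst hS _) (appNum_free hP.1 _)
        ((sF_true hP.1).1 (hsound _ hSs hSf hp))
    · have hn := iter_true hsound hS hP _ k h4
      refine ⟨?_, hn⟩
      have ht := hsound _ (sigma1_subst hS _) (appNum_free hP.1 _)
        (proves_mono hext ((hP.2 _).1 hn))
      exact proves_mono hext (sigma1_complete hSs hSf ((sF_true hP.1).2 ht))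
  exact hcons (explode _ hboth.1 hboth.2)

end PLN
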